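/- For every s ≥ 0, the function x ↦ Ω_s(x) is differentiable at every rational number p/q written in lowest terms with p and q both odd (q ≥ 1). -/

import Mathlib

open Complex Filter Finset

noncomputable section

/-- `ρ = e^{iπ/4}`. -/
def ρ : ℂ := Complex.exp (Real.pi * Complex.I / 4)

/-- Partial sum `F_{s,n}(x,t) = Σ_{k=1}^{n} e^{iπk²x + 2πikt}/k^s`. -/
def Fpart (s : ℝ) (n : ℕ) (x t : ℝ) : ℂ :=
  ∑ k ∈ Finset.Icc 1 n,
    Complex.exp (Real.pi * Complex.I * (k : ℂ) ^ 2 * (x : ℂ)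
        + 2 * Real.pi * Complex.I * (k : ℂ) * (t : ℂ)) / (k : ℂ) ^ (s : ℂ)

/-- The function `I_s(x,t)` (for `x > 0`). -/
def Ifun (s x t : ℝ) : ℂ :=
  (∫ u : ℝ, ρ *
      (Complex.exp (Real.pi * Complex.I * ((1 : ℂ) / 2 + ρ * (u : ℂ)) ^ 2 * (x : ℂ)
            + 2 * Real.pi * Complex.I * ((1 : ℂ) / 2 + ρ * (u : ℂ)) * (Int.fract t : ℝ)) /
        (((1 : ℂ) / 2 + ρ * (u : ℂ)) ^ (s : ℂ) *
          (1 - Complex.exp (2 * Real.pi * Complex.I * ((1 : ℂ) / 2 + ρ * (u : ℂ)))))))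
  + ρ * (x : ℂ) ^ (s : ℂ) *
    ∫ u : ℝ, (Real.exp (-(Real.pi * x * u ^ 2)) : ℝ) *
      ∑' k : ℕ, Complex.exp (-(Real.pi * Complex.I * (((k : ℂ) + 1) - (Int.fract t : ℝ)) ^ 2 / (x : ℂ))) *
        (((ρ * (x : ℂ) * (u : ℂ) + ((k : ℂ) + 1) - (Int.fract t : ℝ)) ^ (s : ℂ))⁻¹
          - (((k : ℂ) + 1) ^ (s : ℂ))⁻¹)

/-- `Ω_s(x,t)`. -/
def Omega (s x t : ℝ) : ℂ :=
  if 0 < x then Ifun s x t else (starRingEnd ℂ) (Ifun s (-x) (-t))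

/-- `Ω_s(x) = Ω_s(x,0)`. -/
def Omega0 (s x : ℝ) : ℂ := Omega s x 0

/-- The map `T(x) = -1/x mod 2`, valued in `(-1,1]`. -/
def Tmap (x : ℝ) : ℝ := -1 / x - 2 * ⌈((-1 / x) - 1) / 2⌉

/-- Denominator `Q_n` of the `n`-th convergent of the regular continued fraction of `x`. -/
def Qden (x : ℝ) (n : ℕ) : ℝ := (GenContFract.of x).dens n

end

open MeasureTheory Topology

lemma rho_eq : ρ = ((√2 / 2 : ℝ) : ℂ) + ((√2 / 2 : ℝ) : ℂ) * Complex.I := by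
  unfold ρ
  rw [show (Real.pi * Complex.I / 4 : ℂ) = ((Real.pi / 4 : ℝ) : ℂ) * Complex.I by push_cast; ring,
    Complex.exp_mul_I, ← Complex.ofReal_cos, ← Complex.ofReal_sin, Real.cos_pi_div_four,
    Real.sin_pi_div_four]

lemma rho_re : ρ.re = √2 / 2 := by simp [rho_eq]

lemma rho_im : ρ.im = √2 / 2 := by simp [rho_eq]

lemma norm_rho : ‖ρ‖ = 1 := by
  unfold ρ
  rw [show (Real.pi * Complex.I / 4 : ℂ) = ((Real.pi / 4 : ℝ) : ℂ) * Complex.I by push_cast; ring,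
    Complex.norm_exp_ofReal_mul_I]

lemma add_rho_mul_mem_slitPlane {a : ℝ} (ha : 0 < a) (w : ℝ) :
    (a : ℂ) + ρ * w ∈ Complex.slitPlane := by
  rw [Complex.mem_slitPlane_iff]
  by_cases hw : w = 0
  · left; simp [hw, ha]
  · right; simp [rho_im, hw]

lemma half_le_norm_add_rho_mul (a w : ℝ) :
    a / 2 ≤ ‖(a : ℂ) + ρ * w‖ := by
  refine le_of_sq_le_sq ?_ (norm_nonneg _)
  rw [← Complex.normSq_eq_norm_sq, Complex.normSq_apply]
  simp only [Complex.add_re, Complex.ofReal_re, Complex.re_mul_ofReal, Complex.add_im,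
    Complex.ofReal_im, Complex.im_mul_ofReal, rho_re, rho_im]
  have h2 : √2 * √2 = 2 := Real.mul_self_sqrt (by norm_num)
  nlinarith [sq_nonneg (a + √2 * w), sq_nonneg (√2 * w)]

/-- The power `(1 + ρ w) ^ r` along the ray through `ρ`. -/
noncomputable def rayPow (r w : ℝ) : ℂ := (1 + ρ * (w : ℂ)) ^ (r : ℂ)

lemma one_add_rho_mul_mem_slitPlane (w : ℝ) : 1 + ρ * (w : ℂ) ∈ Complex.slitPlane := by
  simpa using add_rho_mul_mem_slitPlane one_pos w

lemma norm_rayPow_le {r : ℝ} (hr : r ≤ 0) (w : ℝ) : ‖rayPow r w‖ ≤ (1 / 2 : ℝ) ^ r := by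
  unfold rayPow
  rw [Complex.norm_cpow_real]
  exact Real.rpow_le_rpow_of_nonpos (by norm_num)
    (by simpa using half_le_norm_add_rho_mul 1 w) hr

lemma hasDerivAt_rayPow (r w : ℝ) : HasDerivAt (rayPow r) (r * rayPow (r - 1) w * ρ) w := by
  have h1 : HasDerivAt (fun z : ℂ => 1 + ρ * z) ρ (w : ℂ) := by
    simpa using ((hasDerivAt_id (w : ℂ)).const_mul ρ).const_add 1
  have h2 := (h1.cpow_const (c := (r : ℂ)) (one_add_rho_mul_mem_slitPlane w)).comp_ofReal
  refine HasDerivAt.congr_deriv (f := rayPow r) h2 ?_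
  simp [rayPow]

lemma continuous_rayPow (r : ℝ) : Continuous (rayPow r) :=
  continuous_iff_continuousAt.2 fun w => (hasDerivAt_rayPow r w).continuousAt

lemma norm_rayPow_sub_le {r : ℝ} (hr : r ≤ 0) (v w : ℝ) :
    ‖rayPow r v - rayPow r w‖ ≤ |r| * (1 / 2 : ℝ) ^ (r - 1) * |v - w| := by
  refine Convex.norm_image_sub_le_of_norm_hasDerivWithin_le (s := Set.univ)
    (fun x _ => (hasDerivAt_rayPow r x).hasDerivWithinAt) (fun x _ => ?_) convex_univ
    (Set.mem_univ _) (Set.mem_univ _)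
  rw [norm_mul, norm_mul, norm_rho, mul_one, Complex.norm_real, Real.norm_eq_abs]
  exact mul_le_mul_of_nonneg_left (norm_rayPow_le (by linarith) x) (abs_nonneg r)

lemma rayPow_zero (r : ℝ) : rayPow r 0 = 1 := by simp [rayPow]

/-- The Gaussian mean of `(1 + ρ ε v) ^ (-s) - 1`. -/
noncomputable def gaussMean (s ε : ℝ) : ℂ :=
  ∫ v : ℝ, (Real.exp (-Real.pi * v ^ 2) : ℂ) * (rayPow (-s) (ε * v) - 1)

lemma integrable_abs_mul_gauss {b : ℝ} (hb : 0 < b) :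
    Integrable fun v : ℝ => |v| * Real.exp (-b * v ^ 2) := by
  refine (integrable_mul_exp_neg_mul_sq hb).norm.congr (Eventually.of_forall fun v => ?_)
  simp

lemma integrable_sq_mul_gauss {b : ℝ} (hb : 0 < b) :
    Integrable fun v : ℝ => v ^ 2 * Real.exp (-b * v ^ 2) := by
  simpa using integrable_rpow_mul_exp_neg_mul_sq hb (s := 2) (by norm_num)

lemma hasDerivAt_gaussMean {s : ℝ} (hs : 0 ≤ s) (ε : ℝ) :
    HasDerivAt (gaussMean s) (∫ v : ℝ, (Real.exp (-Real.pi * v ^ 2) : ℂ) *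
      (((-s : ℝ) : ℂ) * rayPow (-s - 1) (ε * v) * ρ * v)) ε := by
  have hcont : ∀ r x : ℝ, Continuous fun v : ℝ => rayPow r (x * v) := fun r x =>
    (continuous_rayPow r).comp (by fun_prop)
  refine (hasDerivAt_integral_of_dominated_loc_of_deriv_le (s := Set.univ)
    (F := fun ε v => (Real.exp (-Real.pi * v ^ 2) : ℂ) * (rayPow (-s) (ε * v) - 1))
    (F' := fun ε v => (Real.exp (-Real.pi * v ^ 2) : ℂ) *
      (((-s : ℝ) : ℂ) * rayPow (-s - 1) (ε * v) * ρ * v))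
    (bound := fun v => s * (1 / 2 : ℝ) ^ (-s - 1) * (|v| * Real.exp (-Real.pi * v ^ 2)))
    Filter.univ_mem (Eventually.of_forall fun x => ?_) ?_ ?_ ?_ ?_ ?_).2
  · have := hcont (-s) x
    exact Continuous.aestronglyMeasurable (by fun_prop)
  · refine (integrable_exp_neg_mul_sq Real.pi_pos).const_mul ((1 / 2 : ℝ) ^ (-s) + 1) |>.mono' ?_ ?_
    · have := hcont (-s) ε
      exact Continuous.aestronglyMeasurable (by fun_prop)
    · refine Eventually.of_forall fun v => ?_
      rw [norm_mul, Complex.norm_real, Real.norm_eq_abs, Real.abs_exp, mul_comm]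
      refine mul_le_mul_of_nonneg_right ((norm_sub_le _ _).trans ?_) (Real.exp_pos _).le
      rw [norm_one]
      exact add_le_add_left (norm_rayPow_le (by linarith) _) _
  · have := hcont (-s - 1) ε
    exact Continuous.aestronglyMeasurable (by fun_prop)
  · refine Eventually.of_forall fun v x _ => ?_
    simp only [norm_mul, Complex.norm_real, Real.norm_eq_abs, Real.abs_exp, norm_rho, abs_neg,
      abs_of_nonneg hs, mul_one]
    have := norm_rayPow_le (r := -s - 1) (by linarith) (x * v)
    calc Real.exp (-Real.pi * v ^ 2) * (s * ‖rayPow (-s - 1) (x * v)‖ * |v|)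
        = s * ‖rayPow (-s - 1) (x * v)‖ * (|v| * Real.exp (-Real.pi * v ^ 2)) := by ring
      _ ≤ _ := by gcongr
  · exact (integrable_abs_mul_gauss Real.pi_pos).const_mul _
  · refine Eventually.of_forall fun v x _ => ?_
    have h1 : HasDerivAt (fun x : ℝ => x * v) v x := by
      simpa using (hasDerivAt_id x).mul_const v
    have h2 := (HasDerivAt.scomp x (hasDerivAt_rayPow (-s) (x * v)) h1)
    refine ((h2.sub_const 1).const_mul _).congr_deriv ?_
    rw [Complex.real_smul]
    ring

lemma gaussMean_zero (s : ℝ) : gaussMean s 0 = 0 := by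
  simp [gaussMean, rayPow_zero]

lemma exists_norm_deriv_gaussMean_le {s : ℝ} (hs : 0 ≤ s) :
    ∃ M : ℝ, 0 ≤ M ∧ ∀ ε, ‖deriv (gaussMean s) ε‖ ≤ M * |ε| := by
  set L : ℝ := |-s - 1| * (1 / 2 : ℝ) ^ (-s - 1 - 1) with hL
  have hL0 : 0 ≤ L := by positivity
  refine ⟨s * L * ∫ v : ℝ, v ^ 2 * Real.exp (-Real.pi * v ^ 2), ?_, fun ε => ?_⟩
  · exact mul_nonneg (by positivity) (integral_nonneg fun v => by positivity)
  have hodd : ∫ v : ℝ, (Real.exp (-Real.pi * v ^ 2) : ℂ) * (((-s : ℝ) : ℂ) * ρ * v) = 0 := by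
    have h := integral_neg_eq_self
      (fun v : ℝ => (Real.exp (-Real.pi * v ^ 2) : ℂ) * (((-s : ℝ) : ℂ) * ρ * v)) volume
    simp only [neg_sq, Complex.ofReal_neg (_ : ℝ), mul_neg, integral_neg] at h ⊢
    exact self_eq_neg.1 h.symm
  have hint : Integrable fun v : ℝ =>
      (Real.exp (-Real.pi * v ^ 2) : ℂ) * (((-s : ℝ) : ℂ) * ρ * v) := by
    refine ((integrable_abs_mul_gauss Real.pi_pos).const_mul s).mono'
      (Continuous.aestronglyMeasurable (by fun_prop)) (Eventually.of_forall fun v => le_of_eq ?_)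
    simp only [norm_mul, Complex.norm_real, Real.norm_eq_abs, Real.abs_exp, norm_rho, abs_neg,
      abs_of_nonneg hs, mul_one]
    ring
  have hint' : Integrable fun v : ℝ => (Real.exp (-Real.pi * v ^ 2) : ℂ) *
      (((-s : ℝ) : ℂ) * rayPow (-s - 1) (ε * v) * ρ * v) := by
    have hc : Continuous fun v : ℝ => rayPow (-s - 1) (ε * v) :=
      (continuous_rayPow _).comp (by fun_prop)
    refine ((integrable_abs_mul_gauss Real.pi_pos).const_mul
      (s * (1 / 2 : ℝ) ^ (-s - 1))).mono'
      (Continuous.aestronglyMeasurable (by fun_prop)) (Eventually.of_forall fun v => ?_)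
    simp only [norm_mul, Complex.norm_real, Real.norm_eq_abs, Real.abs_exp, norm_rho, abs_neg,
      abs_of_nonneg hs, mul_one]
    have := norm_rayPow_le (r := -s - 1) (by linarith) (ε * v)
    calc Real.exp (-Real.pi * v ^ 2) * (s * ‖rayPow (-s - 1) (ε * v)‖ * |v|)
        = s * ‖rayPow (-s - 1) (ε * v)‖ * (|v| * Real.exp (-Real.pi * v ^ 2)) := by ring
      _ ≤ _ := by gcongr
  rw [(hasDerivAt_gaussMean hs ε).deriv, ← sub_zero (∫ v : ℝ, _), ← hodd,
    ← integral_sub hint' hint]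
  calc _ ≤ ∫ v : ℝ, s * L * |ε| * (v ^ 2 * Real.exp (-Real.pi * v ^ 2)) := by
        refine norm_integral_le_of_norm_le ((integrable_sq_mul_gauss Real.pi_pos).const_mul _)
          (Eventually.of_forall fun v => ?_)
        have h := norm_rayPow_sub_le (r := -s - 1) (by linarith) (ε * v) 0
        rw [rayPow_zero, sub_zero, abs_mul, ← hL] at h
        rw [show (Real.exp (-Real.pi * v ^ 2) : ℂ) *
            (((-s : ℝ) : ℂ) * rayPow (-s - 1) (ε * v) * ρ * v) -
            (Real.exp (-Real.pi * v ^ 2) : ℂ) * (((-s : ℝ) : ℂ) * ρ * v) =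
            (Real.exp (-Real.pi * v ^ 2) : ℂ) *
              (((-s : ℝ) : ℂ) * (rayPow (-s - 1) (ε * v) - 1) * ρ * v) by ring]
        simp only [norm_mul, Complex.norm_real, Real.norm_eq_abs, Real.abs_exp, norm_rho, abs_neg,
          abs_of_nonneg hs, mul_one]
        calc Real.exp (-Real.pi * v ^ 2) * (s * ‖rayPow (-s - 1) (ε * v) - 1‖ * |v|)
            ≤ Real.exp (-Real.pi * v ^ 2) * (s * (L * (|ε| * |v|)) * |v|) := by gcongr
          _ = s * L * |ε| * (|v| ^ 2 * Real.exp (-Real.pi * v ^ 2)) := by ring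
          _ = _ := by rw [sq_abs]
    _ = _ := by rw [integral_const_mul]; ring

lemma exists_norm_gaussMean_sub_le {s : ℝ} (hs : 0 ≤ s) :
    ∃ M : ℝ, 0 ≤ M ∧ ∀ r a b : ℝ, |a| ≤ r → |b| ≤ r →
      ‖gaussMean s a - gaussMean s b‖ ≤ M * r * |a - b| := by
  obtain ⟨M, hM, h⟩ := exists_norm_deriv_gaussMean_le hs
  refine ⟨M, hM, fun r a b ha hb => ?_⟩
  refine Convex.norm_image_sub_le_of_norm_hasDerivWithin_le (s := Set.Icc (-r) r)
    (fun x _ => (hasDerivAt_gaussMean hs x).differentiableAt.hasDerivAt.hasDerivWithinAt)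
    (fun x hx => (h x).trans ?_) (convex_Icc _ _) (abs_le.1 hb) (abs_le.1 ha)
  exact mul_le_mul_of_nonneg_left (abs_le.2 hx) hM

/-- Only the difference quotients at the point itself have to be dominated. -/
lemma differentiableAt_tsum_of_norm_sub_le {f : ℕ → ℝ → ℂ} {x₀ : ℝ} {B : ℕ → ℝ}
    (hB : Summable B) (hf : ∀ k, DifferentiableAt ℝ (f k) x₀)
    (hsum : ∀ᶠ x in 𝓝 x₀, Summable fun k => f k x)
    (hbd : ∀ᶠ x in 𝓝 x₀, ∀ k, ‖f k x - f k x₀‖ ≤ B k * |x - x₀|) :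
    DifferentiableAt ℝ (fun x => ∑' k, f k x) x₀ := by
  have key : Tendsto (fun x => ∑' k, slope (f k) x₀ x) (𝓝[≠] x₀)
      (𝓝 (∑' k, deriv (f k) x₀)) := by
    refine tendsto_tsum_of_dominated_convergence hB
      (fun k => hasDerivAt_iff_tendsto_slope.1 (hf k).hasDerivAt) ?_
    filter_upwards [hbd.filter_mono nhdsWithin_le_nhds, self_mem_nhdsWithin] with x hx hne k
    have hpos : 0 < |x - x₀| := abs_pos.2 (sub_ne_zero.2 hne)
    rw [slope_def_module, norm_smul, norm_inv, Real.norm_eq_abs, inv_mul_le_iff₀ hpos, mul_comm]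
    exact hx k
  refine (hasDerivAt_iff_tendsto_slope.2 (key.congr' ?_)).differentiableAt
  filter_upwards [hsum.filter_mono nhdsWithin_le_nhds] with x hx
  rw [slope_def_module, ← hx.tsum_sub hsum.self_of_nhds, ← tsum_const_smul'']
  rfl

lemma norm_exp_I_mul_sub_exp_I_mul_le (a b : ℝ) :
    ‖Complex.exp (Complex.I * a) - Complex.exp (Complex.I * b)‖ ≤ |a - b| := by
  have : Complex.exp (Complex.I * a) - Complex.exp (Complex.I * b) =
      Complex.exp (Complex.I * b) * (Complex.exp (Complex.I * ((a - b : ℝ) : ℂ)) - 1) := by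
    rw [mul_sub, ← Complex.exp_add, mul_one]
    congr 2
    push_cast
    ring
  rw [this, norm_mul, Complex.norm_exp_I_mul_ofReal, one_mul]
  exact Real.norm_exp_I_mul_ofReal_sub_one_le

lemma norm_exp_I_mul_sub_one_le (a : ℝ) : ‖Complex.exp (Complex.I * a) - 1‖ ≤ |a| := by
  simpa using norm_exp_I_mul_sub_exp_I_mul_le a 0

/-- The amplitude `n ^ (-s) * gaussMean s (√x / n)` at `n = k + 1`. -/
noncomputable def amp (s : ℝ) (k : ℕ) (x : ℝ) : ℂ :=
  (((k + 1 : ℝ) ^ (-s) : ℝ) : ℂ) * gaussMean s (√x / (k + 1))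

/-- The phase `exp (iπ n² y)` at `n = k + 1`. -/
noncomputable def phase (k : ℕ) (y : ℝ) : ℂ :=
  Complex.exp (Complex.I * ((Real.pi * (k + 1) ^ 2 * y : ℝ) : ℂ))

lemma norm_phase (k : ℕ) (y : ℝ) : ‖phase k y‖ = 1 := Complex.norm_exp_I_mul_ofReal _

lemma phase_add (k : ℕ) (y z : ℝ) : phase k (y + z) = phase k y * phase k z := by
  unfold phase
  rw [← Complex.exp_add]
  congr 1
  push_cast
  ring

lemma phase_antiperiodic {p q : ℕ} (hp : Odd p) (hq : Odd q) (k : ℕ) :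
    phase (k + p) (-(q / p : ℝ)) = -phase k (-(q / p : ℝ)) := by
  have hp0 : (p : ℂ) ≠ 0 := by exact_mod_cast hp.pos.ne'
  obtain ⟨m, hm⟩ : Odd (2 * (k + 1) * q + p * q) :=
    Even.add_odd ⟨(k + 1) * q, by ring⟩ (hp.mul hq)
  have hm' : (2 * (k + 1) * q + p * q : ℂ) = 2 * m + 1 := by exact_mod_cast hm
  have : Complex.I * ((Real.pi * ((k + p : ℕ) + 1) ^ 2 * (-(q / p : ℝ)) : ℝ) : ℂ) =
      Complex.I * ((Real.pi * (k + 1) ^ 2 * (-(q / p : ℝ)) : ℝ) : ℂ) +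
        -(m * (2 * Real.pi * Complex.I) + Real.pi * Complex.I) := by
    have e : (m : ℂ) * (2 * Real.pi * Complex.I) + Real.pi * Complex.I =
        (2 * (k + 1) * q + p * q) * (Real.pi * Complex.I) := by rw [hm']; ring
    rw [e]
    push_cast
    field_simp
    ring
  unfold phase
  rw [this, Complex.exp_add, Complex.exp_neg, Complex.exp_add, Complex.exp_nat_mul_two_pi_mul_I,
    Complex.exp_pi_mul_I]
  norm_num

lemma summable_succ_rpow {r : ℝ} (hr : r < -1) : Summable fun k : ℕ => (k + 1 : ℝ) ^ r := by
  simpa using (summable_nat_add_iff 1).2 (Real.summable_nat_rpow.2 hr)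

lemma sqrt_div_succ_le {X x : ℝ} (hx : x ≤ X) (k : ℕ) :
    |√x / (k + 1)| ≤ √X / (k + 1) := by
  rw [abs_of_nonneg (by positivity)]
  gcongr

/-- Size, variation in the index and variation in `x` of the amplitudes. -/
lemma exists_amp_bounds {s X : ℝ} (hs : 0 ≤ s) (p : ℕ) :
    ∃ M : ℝ, 0 ≤ M ∧ (∀ k x, x ≤ X → ‖amp s k x‖ ≤ M * (k + 1 : ℝ) ^ (-s - 2)) ∧
      (∀ k x, x ≤ X → ‖amp s (k + p) x - amp s k x‖ ≤ M * (k + 1 : ℝ) ^ (-s - 3)) ∧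
      ∀ k x y, x ≤ X → y ≤ X →
        ‖amp s k x - amp s k y‖ ≤ M * (k + 1 : ℝ) ^ (-s - 2) * |√x - √y| := by
  obtain ⟨M, hM, h⟩ := exists_norm_gaussMean_sub_le hs
  have hpow : ∀ (k : ℕ) (j : ℕ), (k + 1 : ℝ) ^ (-s - j) = (k + 1 : ℝ) ^ (-s) / (k + 1) ^ j := by
    intro k j
    rw [Real.rpow_sub (by positivity), Real.rpow_natCast]
  have hG : ∀ (k : ℕ) x, x ≤ X → ‖gaussMean s (√x / (k + 1))‖ ≤ M * √X ^ 2 / (k + 1) ^ 2 := by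
    intro k x hx
    have := h (√X / (k + 1)) (√x / (k + 1)) 0 (sqrt_div_succ_le hx k) (by simp; positivity)
    rw [gaussMean_zero, sub_zero, sub_zero] at this
    calc _ ≤ _ := this
      _ ≤ M * (√X / (k + 1)) * (√X / (k + 1)) := by
        gcongr; exact sqrt_div_succ_le hx k
      _ = _ := by field_simp
  have hna : ∀ k x, ‖amp s k x‖ = (k + 1 : ℝ) ^ (-s) * ‖gaussMean s (√x / (k + 1))‖ := by
    intro k x
    rw [amp, norm_mul, Complex.norm_real, Real.norm_of_nonneg (by positivity)]
  have hvar : ∀ k : ℕ, |((k + p : ℕ) + 1 : ℝ) ^ (-s) - (k + 1 : ℝ) ^ (-s)| ≤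
      s * p * ((k + 1 : ℝ) ^ (-s) / (k + 1)) := by
    intro k
    have hk : (0 : ℝ) < k + 1 := by positivity
    have := Convex.norm_image_sub_le_of_norm_hasDerivWithin_le (𝕜 := ℝ) (G := ℝ)
      (f := fun t : ℝ => t ^ (-s)) (f' := fun t => -s * t ^ (-s - 1))
      (s := Set.Ici (k + 1 : ℝ)) (x := (k + 1 : ℝ)) (y := ((k + p : ℕ) + 1 : ℝ))
      (C := s * (k + 1 : ℝ) ^ (-s - 1))
      (fun t ht => (Real.hasDerivAt_rpow_const
        (Or.inl (hk.trans_le ht).ne')).hasDerivWithinAt)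
      (fun t ht => ?_) (convex_Ici _) Set.self_mem_Ici (by push_cast; simp)
    · simp only [Real.norm_eq_abs] at this
      refine this.trans (le_of_eq ?_)
      rw [show (((k + p : ℕ) + 1 : ℝ) - (k + 1)) = p by push_cast; ring, Nat.abs_cast,
        Real.rpow_sub_one hk.ne']
      ring
    · rw [norm_mul, Real.norm_eq_abs, Real.norm_eq_abs, abs_neg, abs_of_nonneg hs,
        abs_of_nonneg (Real.rpow_nonneg (hk.trans_le ht).le _)]
      exact mul_le_mul_of_nonneg_left
        (Real.rpow_le_rpow_of_nonpos hk ht (by linarith)) hs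
  refine ⟨max (M * √X ^ 2 * (s * p + p)) (max (M * √X ^ 2) (M * √X)),
    le_max_of_le_right (le_max_of_le_right (by positivity)), ?_, ?_, ?_⟩
  · intro k x hx
    rw [hna]
    calc _ ≤ (k + 1 : ℝ) ^ (-s) * (M * √X ^ 2 / (k + 1) ^ 2) := by gcongr; exact hG k x hx
      _ = M * √X ^ 2 * (k + 1 : ℝ) ^ (-s - 2) := by
        rw [show (-s - 2 : ℝ) = -s - (2 : ℕ) by norm_num, hpow]; ring
      _ ≤ _ := by gcongr; simp
  · intro k x hx
    have hk : (0 : ℝ) < k + 1 := by positivity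
    have hkp : (k + 1 : ℝ) ≤ (k + p : ℕ) + 1 := by push_cast; linarith [p.cast_nonneg (α := ℝ)]
    have hd : ‖gaussMean s (√x / ((k + p : ℕ) + 1)) - gaussMean s (√x / (k + 1))‖ ≤
        M * √X ^ 2 * p / (k + 1) ^ 3 := by
      have h1 : |√x / ((k + p : ℕ) + 1)| ≤ √X / (k + 1) :=
        (sqrt_div_succ_le hx _).trans (by gcongr)
      refine (h _ _ _ h1 (sqrt_div_succ_le hx k)).trans ?_
      have e : |√x / ((k + p : ℕ) + 1) - √x / (k + 1)| =
          √x * p / (((k + p : ℕ) + 1) * (k + 1)) := by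
        rw [abs_sub_comm, abs_of_nonneg]
        · push_cast
          field_simp
          ring
        · rw [sub_nonneg]; gcongr
      rw [e]
      calc _ ≤ M * (√X / (k + 1)) * (√X * p / ((k + 1) * (k + 1))) := by gcongr
        _ = _ := by field_simp
    have e : amp s (k + p) x - amp s k x =
        (((((k + p : ℕ) + 1 : ℝ) ^ (-s) - (k + 1 : ℝ) ^ (-s) : ℝ)) : ℂ) *
          gaussMean s (√x / ((k + p : ℕ) + 1)) + (((k + 1 : ℝ) ^ (-s) : ℝ) : ℂ) *
          (gaussMean s (√x / ((k + p : ℕ) + 1)) - gaussMean s (√x / (k + 1))) := by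
      unfold amp
      rw [Complex.ofReal_sub]
      ring
    rw [e]
    refine (norm_add_le _ _).trans ?_
    rw [norm_mul, norm_mul, Complex.norm_real, Complex.norm_real, Real.norm_eq_abs,
      Real.norm_of_nonneg (by positivity : (0 : ℝ) ≤ (k + 1 : ℝ) ^ (-s))]
    calc _ ≤ s * p * ((k + 1 : ℝ) ^ (-s) / (k + 1)) * (M * √X ^ 2 / (k + 1) ^ 2) +
          (k + 1 : ℝ) ^ (-s) * (M * √X ^ 2 * p / (k + 1) ^ 3) := by
          gcongr
          · exact hvar k
          · exact (hG (k + p) x hx).trans (by gcongr)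
      _ = M * √X ^ 2 * (s * p + p) * (k + 1 : ℝ) ^ (-s - 3) := by
        rw [show (-s - 3 : ℝ) = -s - (3 : ℕ) by norm_num, hpow]; field_simp
      _ ≤ _ := by gcongr; simp
  · intro k x y hx hy
    rw [amp, amp, ← mul_sub, norm_mul, Complex.norm_real, Real.norm_of_nonneg (by positivity)]
    have hk : (0 : ℝ) < k + 1 := by positivity
    calc _ ≤ (k + 1 : ℝ) ^ (-s) * (M * (√X / (k + 1)) * |√x / (k + 1) - √y / (k + 1)|) := by
          gcongr; exact h _ _ _ (sqrt_div_succ_le hx k) (sqrt_div_succ_le hy k)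
      _ = M * √X * (k + 1 : ℝ) ^ (-s - 2) * |√x - √y| := by
        rw [show (-s - 2 : ℝ) = -s - (2 : ℕ) by norm_num, hpow, ← sub_div, abs_div, abs_of_pos hk]
        field_simp
      _ ≤ _ := by gcongr; simp

lemma differentiableAt_amp {s : ℝ} (hs : 0 ≤ s) (k : ℕ) {x : ℝ} (hx : 0 < x) :
    DifferentiableAt ℝ (amp s k) x := by
  have h1 : DifferentiableAt ℝ (fun x : ℝ => √x / (k + 1)) x :=
    (Real.hasDerivAt_sqrt hx.ne').differentiableAt.div_const _
  have h2 : DifferentiableAt ℝ (fun x : ℝ => gaussMean s (√x / (k + 1))) x :=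
    DifferentiableAt.comp (g := gaussMean s) x (hasDerivAt_gaussMean hs _).differentiableAt h1
  exact h2.const_mul _

lemma differentiableAt_phase (k : ℕ) {g : ℝ → ℝ} {x : ℝ} (hg : DifferentiableAt ℝ g x) :
    DifferentiableAt ℝ (fun x => phase k (g x)) x := by
  have : DifferentiableAt ℝ (fun x => Real.pi * (k + 1) ^ 2 * g x) x := hg.const_mul _
  exact (this.hasDerivAt.ofReal_comp.differentiableAt.const_mul _).cexp

lemma summable_of_norm_le_rpow {f : ℕ → ℂ} {M r : ℝ} (hr : r < -1)
    (h : ∀ k, ‖f k‖ ≤ M * (k + 1 : ℝ) ^ r) : Summable f :=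
  Summable.of_norm_bounded ((summable_succ_rpow hr).mul_left M) h

/-- Antiperiodicity of the phases of `-q / p` turns the series into a finite sum and a series of
differences. -/
lemma tsum_phase_mul_eq {p q : ℕ} (hp : Odd p) (hq : Odd q) {c : ℕ → ℂ} (hc : Summable c) :
    ∑' k, phase k (-(q / p : ℝ)) * c k =
      (∑ k ∈ Finset.range p, phase k (-(q / p : ℝ)) * c k +
        ∑' k, phase k (-(q / p : ℝ)) * (c k - c (k + p))) / 2 := by
  have hsum : ∀ d : ℕ → ℂ, Summable d → Summable fun k => phase k (-(q / p : ℝ)) * d k := by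
    intro d hd
    refine Summable.of_norm (hd.norm.congr fun k => ?_)
    rw [norm_mul, norm_phase, one_mul]
  have hc' : Summable fun k => c (k + p) := (summable_nat_add_iff p).2 hc
  have h1 := (hsum c hc).sum_add_tsum_nat_add p
  simp only [phase_antiperiodic hp hq, neg_mul, tsum_neg] at h1
  simp only [mul_sub]
  rw [(hsum c hc).tsum_sub (hsum _ hc')]
  linear_combination (-1 / 2 : ℂ) * h1

lemma differentiableAt_tsum_phase_mul_amp {s : ℝ} (hs : 0 < s) {p q : ℕ} (hp : Odd p)
    (hq : Odd q) :
    DifferentiableAt ℝ (fun x : ℝ => ∑' k, phase k (-x⁻¹) * amp s k x) (p / q : ℝ) := by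
  have hp0 : (0 : ℝ) < p := by exact_mod_cast hp.pos
  have hq0 : (0 : ℝ) < q := by exact_mod_cast hq.pos
  set x₀ : ℝ := p / q with hx₀
  have hx0 : 0 < x₀ := by positivity
  obtain ⟨M, hM, hA, hB, hC⟩ := exists_amp_bounds (X := 2 * x₀) hs.le p
  set η : ℝ → ℝ := fun x => x₀⁻¹ - x⁻¹ with hη
  set c : ℕ → ℝ → ℂ := fun k x => phase k (η x) * amp s k x with hc
  have hηd : ∀ x, 0 < x → DifferentiableAt ℝ η x := fun x hx =>
    (differentiableAt_inv hx.ne').const_sub _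
  have hcd : ∀ k, DifferentiableAt ℝ (c k) x₀ := fun k =>
    (differentiableAt_phase k (hηd _ hx0)).mul (differentiableAt_amp hs.le k hx0)
  have hcsum : ∀ x, x ≤ 2 * x₀ → Summable fun k => c k x := fun x hx =>
    summable_of_norm_le_rpow (M := M) (r := -s - 2) (by linarith) fun k => by
      rw [hc, norm_mul, norm_phase, one_mul]
      exact hA k x hx
  have hle : ∀ᶠ x in 𝓝 x₀, x ≤ 2 * x₀ ∧ x₀ / 2 ≤ x :=
    (eventually_le_nhds (by linarith)).and (eventually_ge_nhds (by linarith))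
  have hηb : ∃ K : ℝ, 0 ≤ K ∧ ∀ x, x₀ / 2 ≤ x → |η x| ≤ K * |x - x₀| := by
    refine ⟨2 / x₀ ^ 2, by positivity, fun x hx => ?_⟩
    have hx' : 0 < x := by linarith
    have e : η x = (x - x₀) / (x₀ * x) := by
      simp only [hη]; field_simp
    rw [e, abs_div, abs_of_pos (by positivity : 0 < x₀ * x), div_le_iff₀ (by positivity)]
    have : 1 ≤ 2 / x₀ ^ 2 * (x₀ * x) := by
      rw [div_mul_eq_mul_div, le_div_iff₀ (by positivity)]
      nlinarith
    nlinarith [abs_nonneg (x - x₀)]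
  have hsq : ∃ K : ℝ, 0 ≤ K ∧ ∀ x, x₀ / 2 ≤ x → |√x - √x₀| ≤ K * |x - x₀| := by
    refine ⟨1 / √x₀, by positivity, fun x hx => ?_⟩
    have hr : 0 < √x₀ := Real.sqrt_pos.2 hx0
    have e : |x - x₀| = |√x - √x₀| * (√x + √x₀) := by
      rw [← abs_of_nonneg (by positivity : 0 ≤ √x + √x₀), ← abs_mul]
      congr 1
      nlinarith [Real.sq_sqrt hx0.le, Real.sq_sqrt (by linarith : 0 ≤ x)]
    rw [one_div, inv_mul_eq_div, le_div_iff₀ hr, e]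
    exact mul_le_mul_of_nonneg_left (by linarith [Real.sqrt_nonneg x]) (abs_nonneg _)
  obtain ⟨K, hK, hηK⟩ := hηb
  obtain ⟨K', hK', hsqK⟩ := hsq
  set α : ℕ → ℂ := fun k => phase k (-(q / p : ℝ)) with hα
  have hphase : ∀ k x, phase k (-x⁻¹) = α k * phase k (η x) := by
    intro k x
    rw [hα, ← phase_add]
    congr 1
    simp only [hη, hx₀, inv_div]
    ring
  have hmain : DifferentiableAt ℝ (fun x => ∑' k, α k * (c k x - c (k + p) x)) x₀ := by
    set L : ℝ := Real.pi * K * M * (2 * p + p ^ 2 + 1) + 2 * (M * K') with hL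
    refine differentiableAt_tsum_of_norm_sub_le (B := fun k => L * (k + 1 : ℝ) ^ (-s - 1))
      ((summable_succ_rpow (by linarith)).mul_left _)
      (fun k => ((hcd k).sub (hcd (k + p))).const_mul _) ?_ ?_
    · filter_upwards [hle] with x hx
      have h := (hcsum x hx.1).sub ((summable_nat_add_iff p).2 (hcsum x hx.1))
      refine Summable.of_norm (h.norm.congr fun k => ?_)
      rw [norm_mul, hα, norm_phase, one_mul]
    · filter_upwards [hle] with x hx k
      have hk : (1 : ℝ) ≤ k + 1 := by linarith [k.cast_nonneg (α := ℝ)]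
      have hk0 : (0 : ℝ) < k + 1 := by linarith
      have hη0 : η x₀ = 0 := by simp [hη]
      have hph0 : ∀ k, phase k 0 = 1 := fun k => by simp [phase]
      have hx₀' : x₀ ≤ 2 * x₀ := by linarith
      have split : c k x - c (k + p) x - (c k x₀ - c (k + p) x₀) =
          -((phase (k + p) (η x) - phase k (η x)) * amp s (k + p) x)
          - (phase k (η x) - 1) * (amp s (k + p) x - amp s k x)
          + ((amp s k x - amp s k x₀) - (amp s (k + p) x - amp s (k + p) x₀)) := by
        simp only [hc, hη0, hph0]
        ring
      have hmono : ∀ r : ℝ, r ≤ 0 → ((k + p : ℕ) + 1 : ℝ) ^ r ≤ (k + 1 : ℝ) ^ r := fun r hr =>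
        Real.rpow_le_rpow_of_nonpos hk0 (by push_cast; linarith) hr
      have b1 : ‖phase (k + p) (η x) - phase k (η x)‖ ≤
          Real.pi * (2 * p + p ^ 2) * (k + 1) * |η x| := by
        refine (norm_exp_I_mul_sub_exp_I_mul_le _ _).trans ?_
        rw [← sub_mul, abs_mul]
        refine mul_le_mul_of_nonneg_right ?_ (abs_nonneg _)
        rw [← mul_sub, abs_mul, abs_of_pos Real.pi_pos, mul_assoc Real.pi]
        refine mul_le_mul_of_nonneg_left ?_ Real.pi_pos.le
        push_cast
        rw [show ((k : ℝ) + p + 1) ^ 2 - (k + 1) ^ 2 = 2 * p * (k + 1) + p ^ 2 by ring,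
          abs_of_nonneg (by positivity)]
        nlinarith [sq_nonneg (p : ℝ)]
      have b2 : ‖phase k (η x) - 1‖ ≤ Real.pi * (k + 1) ^ 2 * |η x| := by
        refine (norm_exp_I_mul_sub_one_le _).trans (le_of_eq ?_)
        rw [abs_mul, abs_of_nonneg (by positivity)]
      have b3 := (hA (k + p) x hx.1).trans
        (mul_le_mul_of_nonneg_left (hmono (-s - 2) (by linarith)) hM)
      have b4 := hB k x hx.1
      have b5 := hC k x x₀ hx.1 hx₀'
      have b6 := (hC (k + p) x x₀ hx.1 hx₀').trans
        (mul_le_mul_of_nonneg_right (mul_le_mul_of_nonneg_left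
          (hmono (-s - 2) (by linarith)) hM) (abs_nonneg _))
      have e1 : (k + 1 : ℝ) * (k + 1 : ℝ) ^ (-s - 2) = (k + 1 : ℝ) ^ (-s - 1) := by
        rw [show (-s - 1 : ℝ) = (-s - 2) + 1 by ring, Real.rpow_add_one hk0.ne', mul_comm]
      have e2 : (k + 1 : ℝ) ^ 2 * (k + 1 : ℝ) ^ (-s - 3) = (k + 1 : ℝ) ^ (-s - 1) := by
        rw [show (-s - 1 : ℝ) = (-s - 3) + (2 : ℕ) by push_cast; ring,
          Real.rpow_add_natCast hk0.ne', mul_comm]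
      have e3 : (k + 1 : ℝ) ^ (-s - 2) ≤ (k + 1 : ℝ) ^ (-s - 1) :=
        Real.rpow_le_rpow_of_exponent_le hk (by linarith)
      rw [← mul_sub, norm_mul, hα, norm_phase, one_mul, split]
      have hηx := hηK x hx.2
      have hsx := hsqK x hx.2
      set R := (k + 1 : ℝ) ^ (-s - 1)
      calc _ ≤ ‖phase (k + p) (η x) - phase k (η x)‖ * ‖amp s (k + p) x‖
            + ‖phase k (η x) - 1‖ * ‖amp s (k + p) x - amp s k x‖
            + (‖amp s k x - amp s k x₀‖ + ‖amp s (k + p) x - amp s (k + p) x₀‖) := by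
            refine (norm_add_le _ _).trans (add_le_add ((norm_sub_le _ _).trans ?_)
              (norm_sub_le _ _))
            rw [norm_neg, norm_mul, norm_mul]
        _ ≤ Real.pi * (2 * p + p ^ 2) * (k + 1) * |η x| * (M * (k + 1 : ℝ) ^ (-s - 2))
            + Real.pi * (k + 1) ^ 2 * |η x| * (M * (k + 1 : ℝ) ^ (-s - 3))
            + (M * (k + 1 : ℝ) ^ (-s - 2) * |√x - √x₀|
              + M * (k + 1 : ℝ) ^ (-s - 2) * |√x - √x₀|) := by gcongr
        _ = Real.pi * (2 * p + p ^ 2) * M * |η x| * ((k + 1) * (k + 1 : ℝ) ^ (-s - 2))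
            + Real.pi * M * |η x| * ((k + 1) ^ 2 * (k + 1 : ℝ) ^ (-s - 3))
            + 2 * (M * (k + 1 : ℝ) ^ (-s - 2) * |√x - √x₀|) := by ring
        _ ≤ Real.pi * (2 * p + p ^ 2) * M * (K * |x - x₀|) * R
            + Real.pi * M * (K * |x - x₀|) * R + 2 * (M * R * (K' * |x - x₀|)) := by
            rw [e1, e2]
            gcongr
        _ = L * R * |x - x₀| := by rw [hL]; ring
  have hfin : DifferentiableAt ℝ (fun x => ∑ k ∈ Finset.range p, α k * c k x) x₀ :=
    DifferentiableAt.fun_sum fun k _ => (hcd k).const_mul _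
  refine ((hfin.add hmain).div_const 2).congr_of_eventuallyEq ?_
  filter_upwards [hle] with x hx
  have := tsum_phase_mul_eq hp hq (hcsum x hx.1)
  refine Eq.trans (tsum_congr fun k => ?_) this
  rw [hphase, mul_assoc]

lemma inv_cpow_add_eq (s x u : ℝ) (k : ℕ) :
    ((ρ * (x : ℂ) * (u : ℂ) + ((k : ℂ) + 1)) ^ (s : ℂ))⁻¹ =
      (((k + 1 : ℝ) ^ (-s) : ℝ) : ℂ) * rayPow (-s) (x * u / (k + 1)) := by
  have hk : (0 : ℝ) < k + 1 := by positivity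
  have hk' : ((k : ℂ) + 1) ≠ 0 := by exact_mod_cast hk.ne'
  have hz := Complex.slitPlane_ne_zero (one_add_rho_mul_mem_slitPlane (x * u / (k + 1)))
  have e : ρ * (x : ℂ) * (u : ℂ) + ((k : ℂ) + 1) =
      ((k + 1 : ℝ) : ℂ) * (1 + ρ * ((x * u / (k + 1) : ℝ) : ℂ)) := by
    push_cast
    field_simp
    ring
  rw [e, ← Complex.cpow_neg, rayPow,
    Complex.cpow_def_of_ne_zero (mul_ne_zero (by exact_mod_cast hk.ne') hz),
    Complex.log_ofReal_mul hk hz, add_mul, Complex.exp_add, Complex.ofReal_cpow hk.le,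
    Complex.cpow_def_of_ne_zero (by exact_mod_cast hk.ne'), Complex.cpow_def_of_ne_zero hz,
    Complex.ofReal_log hk.le]
  push_cast
  rfl

lemma inv_cpow_succ_eq (s : ℝ) (k : ℕ) :
    (((k : ℂ) + 1) ^ (s : ℂ))⁻¹ = (((k + 1 : ℝ) ^ (-s) : ℝ) : ℂ) := by
  simpa [rayPow_zero] using inv_cpow_add_eq s 0 0 k

lemma integral_gauss_mul_rayPow (s : ℝ) {x : ℝ} (hx : 0 < x) (k : ℕ) :
    ∫ u : ℝ, (Real.exp (-(Real.pi * x * u ^ 2)) : ℂ) * (rayPow (-s) (x * u / (k + 1)) - 1) =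
      ((√x)⁻¹ : ℝ) * gaussMean s (√x / (k + 1)) := by
  have hr : 0 < √x := Real.sqrt_pos.2 hx
  have h := MeasureTheory.Measure.integral_comp_mul_left (fun v : ℝ =>
    (Real.exp (-Real.pi * v ^ 2) : ℂ) * (rayPow (-s) (√x / (k + 1) * v) - 1)) (√x)
  rw [abs_of_pos (inv_pos.2 hr), Complex.real_smul] at h
  rw [gaussMean, ← h]
  refine integral_congr_ae (Eventually.of_forall fun u => ?_)
  have hs2 : √x * √x = x := Real.mul_self_sqrt hx.le
  have e1 : -(Real.pi * x * u ^ 2) = -Real.pi * (√x * u) ^ 2 := by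
    rw [mul_pow, sq (√x), hs2]; ring
  have e2 : x * u / (k + 1) = √x / (k + 1) * (√x * u) := by
    rw [div_mul_eq_mul_div, ← mul_assoc, hs2]
  simp only [e1, e2]

lemma integral_tsum_eq {s x : ℝ} (hs : 0 < s) (hx : 0 < x) :
    ∫ u : ℝ, (Real.exp (-(Real.pi * x * u ^ 2)) : ℂ) *
      ∑' k : ℕ, Complex.exp (-(Real.pi * Complex.I * ((k : ℂ) + 1) ^ 2 / (x : ℂ))) *
        (((ρ * (x : ℂ) * (u : ℂ) + ((k : ℂ) + 1)) ^ (s : ℂ))⁻¹ - (((k : ℂ) + 1) ^ (s : ℂ))⁻¹) =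
      ((√x)⁻¹ : ℝ) * ∑' k : ℕ, phase k (-x⁻¹) * amp s k x := by
  set F : ℕ → ℝ → ℂ := fun k u => (phase k (-x⁻¹) * (((k + 1 : ℝ) ^ (-s) : ℝ) : ℂ)) *
    ((Real.exp (-(Real.pi * x * u ^ 2)) : ℂ) * (rayPow (-s) (x * u / (k + 1)) - 1)) with hF
  set L : ℝ := |-s| * (1 / 2 : ℝ) ^ (-s - 1) with hL
  have hL0 : 0 ≤ L := by positivity
  have hint : Integrable fun u : ℝ => |u| * Real.exp (-(Real.pi * x) * u ^ 2) :=
    integrable_abs_mul_gauss (by positivity)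
  have hbound : ∀ k u, ‖F k u‖ ≤ L * x * (k + 1 : ℝ) ^ (-s - 1) *
      (|u| * Real.exp (-(Real.pi * x) * u ^ 2)) := by
    intro k u
    have hk : (0 : ℝ) < k + 1 := by positivity
    have h := norm_rayPow_sub_le (r := -s) (by linarith) (x * u / (k + 1)) 0
    rw [rayPow_zero, sub_zero, abs_div, abs_mul, abs_of_pos hx, abs_of_pos hk, ← hL] at h
    rw [hF, norm_mul, norm_mul, norm_mul, norm_phase, one_mul, Complex.norm_real,
      Complex.norm_real, Real.norm_of_nonneg (by positivity), Real.norm_of_nonneg (by positivity),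
      Real.rpow_sub_one hk.ne', ← neg_mul]
    calc _ ≤ (k + 1 : ℝ) ^ (-s) * (Real.exp (-(Real.pi * x) * u ^ 2) *
          (L * (x * |u| / (k + 1)))) := by gcongr
      _ = _ := by ring
  have hFint : ∀ k, Integrable (F k) := by
    intro k
    have hc : Continuous fun u : ℝ => rayPow (-s) (x * u / (k + 1)) :=
      (continuous_rayPow _).comp (by fun_prop)
    exact (hint.const_mul _).mono' (Continuous.aestronglyMeasurable (by fun_prop))
      (Eventually.of_forall (hbound k))
  have hFsum : Summable fun k => ∫ u, ‖F k u‖ := by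
    refine Summable.of_nonneg_of_le (fun k => integral_nonneg fun u => norm_nonneg _) (fun k => ?_)
      ((summable_succ_rpow (r := -s - 1) (by linarith)).mul_left
        (L * x * ∫ u : ℝ, |u| * Real.exp (-(Real.pi * x) * u ^ 2)))
    refine (integral_mono (hFint k).norm (hint.const_mul _) (hbound k)).trans (le_of_eq ?_)
    rw [integral_const_mul]
    ring
  have hswap := integral_tsum_of_summable_integral_norm hFint hFsum
  calc _ = ∫ u, ∑' k, F k u := by
        refine integral_congr_ae (Eventually.of_forall fun u => ?_)
        simp only
        rw [← tsum_mul_left]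
        refine tsum_congr fun k => ?_
        have e : -(Real.pi * Complex.I * ((k : ℂ) + 1) ^ 2 / (x : ℂ)) =
            Complex.I * ((Real.pi * (k + 1) ^ 2 * -x⁻¹ : ℝ) : ℂ) := by
          push_cast
          ring
        rw [inv_cpow_add_eq, inv_cpow_succ_eq, e]
        simp only [hF, phase]
        ring
    _ = _ := by
        rw [← hswap, ← tsum_mul_left]
        refine tsum_congr fun k => ?_
        simp only [hF]
        rw [integral_const_mul, integral_gauss_mul_rayPow s hx, amp]
        ring

lemma half_le_norm_one_sub_exp (u : ℝ) :
    1 / 2 ≤ ‖1 - Complex.exp (2 * Real.pi * Complex.I * ((1 : ℂ) / 2 + ρ * (u : ℂ)))‖ := by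
  set τ : ℝ := Real.pi * √2 * u with hτ
  have e : 2 * Real.pi * Complex.I * ((1 : ℂ) / 2 + ρ * (u : ℂ)) =
      Real.pi * Complex.I + (((-τ : ℝ) : ℂ) + (τ : ℂ) * Complex.I) := by
    rw [rho_eq, hτ]
    push_cast
    linear_combination (Real.pi * √2 * u : ℂ) * Complex.I_sq
  rw [e, Complex.exp_add, Complex.exp_pi_mul_I, neg_one_mul, sub_neg_eq_add]
  set w := Complex.exp (((-τ : ℝ) : ℂ) + (τ : ℂ) * Complex.I) with hw
  have hwn : ‖w‖ = Real.exp (-τ) := by rw [hw, Complex.norm_exp]; simp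
  have hwre : w.re = Real.exp (-τ) * Real.cos τ := by rw [hw, Complex.exp_re]; simp
  rcases le_or_gt |τ| (Real.pi / 2) with h | h
  · have hc := Real.cos_nonneg_of_mem_Icc (abs_le.1 h)
    have h1 := Complex.re_le_norm (1 + w)
    rw [Complex.add_re, Complex.one_re, hwre] at h1
    nlinarith [Real.exp_pos (-τ), mul_nonneg (Real.exp_pos (-τ)).le hc]
  · have h2 : 1 < |τ| := by linarith [Real.pi_gt_three]
    rcases le_or_gt 0 τ with h0 | h0
    · rw [abs_of_nonneg h0] at h2
      have h3 : Real.exp (-τ) ≤ 1 / 2 := by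
        rw [Real.exp_neg, one_div]
        exact inv_anti₀ two_pos (by linarith [Real.add_one_le_exp τ])
      have h4 := norm_sub_le (1 + w) w
      rw [add_sub_cancel_right, norm_one, hwn] at h4
      linarith
    · rw [abs_of_neg h0] at h2
      have h4 := norm_sub_le (1 + w) 1
      rw [add_sub_cancel_left, norm_one, hwn] at h4
      linarith [Real.add_one_le_exp (-τ)]

lemma differentiableAt_contour_integral {s : ℝ} (hs : 0 ≤ s) {x₀ : ℝ} (hx₀ : 0 < x₀) :
    DifferentiableAt ℝ (fun x : ℝ => ∫ u : ℝ, ρ *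
      (Complex.exp (Real.pi * Complex.I * ((1 : ℂ) / 2 + ρ * (u : ℂ)) ^ 2 * (x : ℂ)) /
        (((1 : ℂ) / 2 + ρ * (u : ℂ)) ^ (s : ℂ) *
          (1 - Complex.exp (2 * Real.pi * Complex.I * ((1 : ℂ) / 2 + ρ * (u : ℂ))))))) x₀ := by
  set z : ℝ → ℂ := fun u => (1 : ℂ) / 2 + ρ * (u : ℂ) with hz
  have hzslit : ∀ u, z u ∈ Complex.slitPlane := fun u => by
    simpa [hz] using add_rho_mul_mem_slitPlane (a := 1 / 2) (by norm_num) u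
  have hzlow : ∀ u, 1 / 4 ≤ ‖z u‖ := fun u => by
    have := half_le_norm_add_rho_mul (1 / 2) u
    norm_num at this ⊢
    simpa [hz] using this
  have hzup : ∀ u, ‖z u‖ ≤ 1 + |u| := fun u => by
    refine (norm_add_le _ _).trans ?_
    rw [norm_mul, norm_rho, Complex.norm_real, Real.norm_eq_abs]
    norm_num
  have hzc : Continuous z := by fun_prop
  set D : ℝ → ℂ := fun u => z u ^ (s : ℂ) * (1 - Complex.exp (2 * Real.pi * Complex.I * z u))
    with hD
  have hDlow : ∀ u, (1 / 4 : ℝ) ^ s * (1 / 2) ≤ ‖D u‖ := fun u => by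
    rw [hD, norm_mul, Complex.norm_cpow_real]
    gcongr
    · exact hzlow u
    · exact half_le_norm_one_sub_exp u
  have hd0 : (0 : ℝ) < (1 / 4 : ℝ) ^ s * (1 / 2) := by positivity
  have hDne : ∀ u, D u ≠ 0 := fun u => norm_pos_iff.1 (hd0.trans_le (hDlow u))
  have hDc : Continuous D := by
    refine Continuous.mul (continuous_iff_continuousAt.2 fun u => ?_) (by fun_prop)
    exact hzc.continuousAt.cpow continuousAt_const (hzslit u)
  have hFc : ∀ x : ℝ, Continuous fun u => Complex.exp (Real.pi * Complex.I * z u ^ 2 * x) :=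
    fun x => by fun_prop
  have hexp : ∀ x u : ℝ, x ∈ Set.Ioo (x₀ / 2) (2 * x₀) →
      ‖Complex.exp (Real.pi * Complex.I * z u ^ 2 * x)‖ ≤
        Real.exp (Real.pi * x₀) * Real.exp (-(Real.pi * x₀ / 4) * u ^ 2) := by
    intro x u hx
    have h2 : √2 * √2 = 2 := Real.mul_self_sqrt (by norm_num)
    have hre : (Real.pi * Complex.I * z u ^ 2 * x).re =
        -(Real.pi * x * (√2 / 2 * u + u ^ 2)) := by
      have e : Real.pi * Complex.I * z u ^ 2 * x = ((Real.pi * x : ℝ) : ℂ) *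
          (Complex.I * z u ^ 2) := by push_cast; ring
      rw [e, Complex.re_ofReal_mul, Complex.I_mul_re, sq, Complex.mul_im]
      simp only [hz, Complex.add_re, Complex.add_im, Complex.re_mul_ofReal, Complex.im_mul_ofReal,
        rho_re, rho_im]
      norm_num
      linear_combination (-(Real.pi * x * u ^ 2 / 2)) * h2
    rw [Complex.norm_exp, hre, ← Real.exp_add, Real.exp_le_exp]
    have h3 : -(√2 / 2 * u + u ^ 2) ≤ 1 / 4 - u ^ 2 / 2 := by
      nlinarith [sq_nonneg (u + √2 / 2)]
    have h4 : Real.pi * x * -(√2 / 2 * u + u ^ 2) ≤ Real.pi * x * (1 / 4 - u ^ 2 / 2) :=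
      mul_le_mul_of_nonneg_left h3 (by have := Real.pi_pos; nlinarith [hx.1])
    have h5 : x * (1 / 4 - u ^ 2 / 2) ≤ x₀ - x₀ / 4 * u ^ 2 := by
      nlinarith [hx.1, hx.2, sq_nonneg u]
    nlinarith [Real.pi_pos]
  refine (hasDerivAt_integral_of_dominated_loc_of_deriv_le (𝕜 := ℝ)
    (s := Set.Ioo (x₀ / 2) (2 * x₀))
    (F := fun x u => ρ * (Complex.exp (Real.pi * Complex.I * z u ^ 2 * (x : ℂ)) / D u))
    (F' := fun x u => ρ * (Complex.exp (Real.pi * Complex.I * z u ^ 2 * (x : ℂ)) *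
      (Real.pi * Complex.I * z u ^ 2) / D u))
    (bound := fun u => Real.exp (Real.pi * x₀) / ((1 / 4 : ℝ) ^ s * (1 / 2)) * (2 * Real.pi) *
      (Real.exp (-(Real.pi * x₀ / 4) * u ^ 2) + u ^ 2 * Real.exp (-(Real.pi * x₀ / 4) * u ^ 2)))
    (Ioo_mem_nhds (by linarith) (by linarith)) (Eventually.of_forall fun x => ?_) ?_ ?_ ?_ ?_
    ?_).2.differentiableAt
  · exact (continuous_const.mul ((hFc x).div hDc hDne)).aestronglyMeasurable
  · refine ((integrable_exp_neg_mul_sq (b := Real.pi * x₀ / 4) (by positivity)).const_mul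
      (Real.exp (Real.pi * x₀) / ((1 / 4 : ℝ) ^ s * (1 / 2)))).mono'
      (continuous_const.mul ((hFc x₀).div hDc hDne)).aestronglyMeasurable
      (Eventually.of_forall fun u => ?_)
    rw [norm_mul, norm_rho, one_mul, norm_div, div_mul_eq_mul_div]
    exact div_le_div₀ (by positivity) (hexp x₀ u ⟨by linarith, by linarith⟩) hd0 (hDlow u)
  · exact (continuous_const.mul (((hFc x₀).mul (by fun_prop)).div hDc hDne)).aestronglyMeasurable
  · refine Eventually.of_forall fun u x hx => ?_
    have h1 : ‖(Real.pi * Complex.I * z u ^ 2 : ℂ)‖ ≤ 2 * Real.pi * (1 + u ^ 2) := by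
      rw [norm_mul, norm_mul, Complex.norm_I, Complex.norm_real, norm_pow,
        Real.norm_of_nonneg Real.pi_pos.le, mul_one]
      have h2 : ‖z u‖ ^ 2 ≤ (1 + |u|) ^ 2 := by gcongr; exact hzup u
      have h3 : (1 + |u|) ^ 2 ≤ 2 * (1 + u ^ 2) := by
        nlinarith [sq_nonneg (1 - |u|), sq_abs u]
      nlinarith [Real.pi_pos]
    rw [norm_mul, norm_rho, one_mul, norm_div, norm_mul]
    calc _ ≤ Real.exp (Real.pi * x₀) * Real.exp (-(Real.pi * x₀ / 4) * u ^ 2) *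
          (2 * Real.pi * (1 + u ^ 2)) / ((1 / 4 : ℝ) ^ s * (1 / 2)) :=
          div_le_div₀ (by positivity) (mul_le_mul (hexp x u hx) h1 (norm_nonneg _)
            (by positivity)) hd0 (hDlow u)
      _ = _ := by ring
  · exact ((integrable_exp_neg_mul_sq (by positivity)).add
      (integrable_sq_mul_gauss (by positivity))).const_mul _
  · refine Eventually.of_forall fun u x _ => ?_
    have h1 : HasDerivAt (fun w : ℂ => Real.pi * Complex.I * z u ^ 2 * w)
        (Real.pi * Complex.I * z u ^ 2) (x : ℂ) := by
      simpa using (hasDerivAt_id (x : ℂ)).const_mul (Real.pi * Complex.I * z u ^ 2)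
    exact (h1.cexp.comp_ofReal.div_const _).const_mul _

lemma differentiableAt_Ifun {s : ℝ} (hs : 0 ≤ s) {p q : ℕ} (hp : Odd p) (hq : Odd q) :
    DifferentiableAt ℝ (fun x : ℝ => Ifun s x 0) (p / q : ℝ) := by
  have hx₀ : (0 : ℝ) < p / q := by
    have := hp.pos
    have := hq.pos
    positivity
  have h1 := differentiableAt_contour_integral hs hx₀
  rcases hs.eq_or_lt with rfl | hs'
  · simpa [Ifun] using h1
  have h2 : DifferentiableAt ℝ (fun x : ℝ => ρ * (x : ℂ) ^ (s : ℂ) *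
      (((√x)⁻¹ : ℝ) * ∑' k : ℕ, phase k (-x⁻¹) * amp s k x)) (p / q : ℝ) := by
    have h3 : DifferentiableAt ℝ (fun x : ℝ => (x : ℂ) ^ (s : ℂ)) (p / q : ℝ) :=
      (((hasDerivAt_id _).cpow_const (c := (s : ℂ))
        (Complex.ofReal_mem_slitPlane.2 hx₀)).comp_ofReal).differentiableAt
    have h4 : DifferentiableAt ℝ (fun x : ℝ => (√x)⁻¹) (p / q : ℝ) :=
      ((Real.hasDerivAt_sqrt hx₀.ne').inv (Real.sqrt_pos.2 hx₀).ne').differentiableAt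
    exact (h3.const_mul _).mul (h4.hasDerivAt.ofReal_comp.differentiableAt.mul
      (differentiableAt_tsum_phase_mul_amp hs' hp hq))
  refine (h1.add h2).congr_of_eventuallyEq ?_
  filter_upwards [eventually_gt_nhds hx₀] with x hx
  rw [Pi.add_apply, ← integral_tsum_eq hs' hx]
  simp [Ifun]

/-- `Ω_s` is differentiable at rationals `p/q` with `p, q` both odd. -/
theorem stmt6 (s : ℝ) (hs : 0 ≤ s) (p q : ℤ) (hq : 1 ≤ q) (hp : Odd p) (hqodd : Odd q)
    (hcop : IsCoprime p q) :
    DifferentiableAt ℝ (fun x : ℝ => Omega0 s x) ((p : ℝ) / (q : ℝ)) := by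
  have hq0 : (0 : ℝ) < q := by exact_mod_cast hq
  lift q to ℕ using by lia
  have hqn : Odd q := by exact_mod_cast hqodd
  rcases lt_trichotomy p 0 with hneg | rfl | hpos
  · obtain ⟨n, rfl⟩ : ∃ n : ℕ, p = -n := ⟨p.natAbs, by lia⟩
    have hn : Odd n := by simpa using hp
    have h := differentiableAt_Ifun hs hn hqn
    have e : (((-n : ℤ) : ℝ) / ((q : ℤ) : ℝ)) = -(n / q : ℝ) := by push_cast; ring
    rw [e]
    have h' : DifferentiableAt ℝ (fun x : ℝ => Ifun s (-x) 0) (-(n / q : ℝ)) := by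
      refine DifferentiableAt.comp (g := fun x => Ifun s x 0) _ ?_ differentiableAt_fun_id.neg
      simpa using h
    refine h'.star.congr_of_eventuallyEq ?_
    have hlt : -(n / q : ℝ) < 0 := by
      have := hn.pos
      have := hqn.pos
      rw [neg_lt_zero]
      positivity
    filter_upwards [eventually_lt_nhds hlt] with x hx
    simp [Omega0, Omega, hx.not_gt]
  · exact absurd hp (by decide)
  · lift p to ℕ using hpos.le
    have hpn : Odd p := by exact_mod_cast hp
    have h := differentiableAt_Ifun hs hpn hqn
    simp only [Int.cast_natCast] at hq0 ⊢
    refine h.congr_of_eventuallyEq ?_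
    have hgt : (0 : ℝ) < p / q := by
      have := hpn.pos
      positivity
    filter_upwards [eventually_gt_nhds hgt] with x hx
    simp [Omega0, Omega, hx]
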